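/- arXiv:2212.12275 — 4 statements merged into one kernel-verified Lean document; each statement's English description precedes it below -/
import Mathlib

section
/- Let M be a simple matroid on [n], K a field, and q ≥ 0. Then the degree-q component (I(M)/Λ⁺I(M))^q_K is spanned over K by the residue classes of the boundaries ∂(e_C) of circuits C of cardinality q+1; equivalently, I(M)^q_K = span_K{∂(e_C) : C ∈ C_{q+1}(M)} + (Λ⁺I(M))^q_K. -/
open ExteriorAlgebra

variable (R : Type*) [CommRing R] (n : ℕ)

/-- The generator `e_i` of the exterior algebra on `n` generators. -/
noncomputable def gen (i : Fin n) : ExteriorAlgebra R (Fin n → R) :=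
  ExteriorAlgebra.ι R (Pi.single i 1)

/-- The monomial `e_X = e_{i_1} ∧ ⋯ ∧ e_{i_m}` for `X = {i_1 < ⋯ < i_m}`. -/
noncomputable def eMon (X : Finset (Fin n)) : ExteriorAlgebra R (Fin n → R) :=
  ((X.sort (· ≤ ·)).map (gen R n)).prod

/-- `∂(e_X) = Σ_k (−1)^{k−1} e_{X \ {i_k}}`. -/
noncomputable def bdry (X : Finset (Fin n)) : ExteriorAlgebra R (Fin n → R) :=
  ∑ i ∈ X, (-1 : ExteriorAlgebra R (Fin n → R)) ^ (X.filter (fun j => j < i)).card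
      * eMon R n (X.erase i)

/-- The degree-`q` graded component `Λ^q` of the exterior algebra. -/
noncomputable def lamGrade (q : ℕ) : Submodule R (ExteriorAlgebra R (Fin n → R)) :=
  LinearMap.range (ι R : (Fin n → R) →ₗ[R] ExteriorAlgebra R (Fin n → R)) ^ q

/-- `Λ⁺`, the span of the elements of strictly positive degree. -/
noncomputable def lamPlus : Submodule R (ExteriorAlgebra R (Fin n → R)) :=
  ⨆ i : ℕ, ⨆ _ : 0 < i, lamGrade R n i

/-- The Orlik–Solomon ideal: the (two-sided) ideal generated by the boundaries of circuits. -/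
noncomputable def osIdeal (𝒞 : Set (Finset (Fin n))) :
    Submodule R (ExteriorAlgebra R (Fin n → R)) :=
  Submodule.span R {x | ∃ a b : ExteriorAlgebra R (Fin n → R), ∃ C ∈ 𝒞, x = a * bdry R n C * b}

/-- The decomposable Orlik–Solomon ideal, the product ideal `Λ⁺ I(M)`. -/
noncomputable def decIdeal (𝒞 : Set (Finset (Fin n))) :
    Submodule R (ExteriorAlgebra R (Fin n → R)) :=
  lamPlus R n * osIdeal R n 𝒞

/-- A circuit of a matroid: a minimal dependent (finite) set. -/
def IsCct (M : Matroid (Fin n)) (C : Finset (Fin n)) : Prop :=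
  M.Dep ↑C ∧ ∀ D : Finset (Fin n), D ⊂ C → ¬ M.Dep ↑D

/-- The set of circuits of `M`. -/
def circuits (M : Matroid (Fin n)) : Set (Finset (Fin n)) := {C | IsCct n M C}

/-- A matroid on ground set `Fin n` (i.e. with `M.E = univ`) is simple iff every
two-element subset is independent. -/
def IsSimple (M : Matroid (Fin n)) : Prop :=
  M.E = Set.univ ∧ ∀ e f : Fin n, M.Indep {e, f}

/-- `a` is the `<_π`-minimal element of `C`. -/
def IsMinP (π : Equiv.Perm (Fin n)) (C : Finset (Fin n)) (a : Fin n) : Prop :=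
  a ∈ C ∧ ∀ b ∈ C, π a ≤ π b

/-- `i` is active with respect to `J` (relative to `<_π`): `J ∪ {i}` contains a circuit
whose `<_π`-minimal element is `i`. -/
def IsActive (M : Matroid (Fin n)) (π : Equiv.Perm (Fin n)) (J : Finset (Fin n))
    (i : Fin n) : Prop :=
  ∃ C : Finset (Fin n), IsCct n M C ∧ C ⊆ insert i J ∧ IsMinP n π C i

/-- `a = α_π(C)`: the `<_π`-smallest element active with respect to `C \ {min_{<_π}(C)}`. -/
def IsAlpha (M : Matroid (Fin n)) (π : Equiv.Perm (Fin n)) (C : Finset (Fin n))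
    (a : Fin n) : Prop :=
  ∃ m, IsMinP n π C m ∧ IsActive n M π (C.erase m) a ∧
    ∀ b, IsActive n M π (C.erase m) b → π a ≤ π b

/-- Condition (1): `C` is a circuit with `min_{<_π}(C) = α_π(C)`. -/
def SatOne (M : Matroid (Fin n)) (π : Equiv.Perm (Fin n)) (C : Finset (Fin n)) : Prop :=
  IsCct n M C ∧ ∃ a, IsMinP n π C a ∧ IsAlpha n M π C a

/-- `C ∈ 𝒞^π(M)`: condition (1) plus inclusion-minimality of `C \ {α_π(C)}`. -/
def InCpi (M : Matroid (Fin n)) (π : Equiv.Perm (Fin n)) (C : Finset (Fin n)) : Prop :=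
  SatOne n M π C ∧
    ∀ C' a a', SatOne n M π C' → IsAlpha n M π C a → IsAlpha n M π C' a' →
      C'.erase a' ⊆ C.erase a → C'.erase a' = C.erase a

section Grading

variable {R n}

lemma eMon_mem_lamGrade (X : Finset (Fin n)) : eMon R n X ∈ lamGrade R n X.card := by
  have h := SetLike.list_prod_map_mem_graded (A := fun i : ℕ ↦ ⋀[R]^i (Fin n → R))
    (X.sort (· ≤ ·)) (fun _ ↦ 1) (gen R n)
    (fun j _ ↦ by
      change gen R n j ∈ LinearMap.range (ι R : (Fin n → R) →ₗ[R] _) ^ 1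
      rw [pow_one]
      exact LinearMap.mem_range_self _ _)
  simpa [eMon, lamGrade] using h

lemma neg_one_pow_mul_mem {p : Submodule R (ExteriorAlgebra R (Fin n → R))}
    {x : ExteriorAlgebra R (Fin n → R)} (k : ℕ) (hx : x ∈ p) :
    (-1 : ExteriorAlgebra R (Fin n → R)) ^ k * x ∈ p := by
  rcases neg_one_pow_eq_or (ExteriorAlgebra R (Fin n → R)) k with h | h <;> simpa [h] using hx

lemma bdry_mem_lamGrade (X : Finset (Fin n)) : bdry R n X ∈ lamGrade R n (X.card - 1) := by
  refine Submodule.sum_mem _ fun i hi ↦ neg_one_pow_mul_mem _ ?_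
  rw [← Finset.card_erase_of_mem hi]
  exact eMon_mem_lamGrade _

lemma mul_mem_lamGrade {i j : ℕ} {x y : ExteriorAlgebra R (Fin n → R)}
    (hx : x ∈ lamGrade R n i) (hy : y ∈ lamGrade R n j) : x * y ∈ lamGrade R n (i + j) := by
  rw [lamGrade, pow_add]
  exact Submodule.mul_mem_mul hx hy

lemma mem_lamPlus {i : ℕ} (hi : 0 < i) {x : ExteriorAlgebra R (Fin n → R)}
    (hx : x ∈ lamGrade R n i) : x ∈ lamPlus R n :=
  Submodule.mem_iSup_of_mem i (Submodule.mem_iSup_of_mem hi hx)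

/-- A vector commutes up to the sign `(-1)^i` with elements of degree `i`. -/
lemma mul_ι_eq_neg_one_pow_mul {i : ℕ} {x : ExteriorAlgebra R (Fin n → R)}
    (hx : x ∈ lamGrade R n i) (v : Fin n → R) :
    x * ι R v = (-1) ^ i * (ι R v * x) := by
  unfold lamGrade at hx
  induction hx using Submodule.pow_induction_on_left' with
  | algebraMap r => simpa using Algebra.commutes r (ι R v)
  | add x y i _ _ hx hy => rw [add_mul, hx, hy, mul_add, mul_add]
  | mem_mul m hm i x _ ih =>
    obtain ⟨w, rfl⟩ := hm
    have hswap : ι R w * ι R v = -(ι R v * ι R w) :=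
      eq_neg_of_add_eq_zero_left (ι_add_mul_swap w v)
    have hcomm : ι R w * (-1 : ExteriorAlgebra R (Fin n → R)) ^ i = (-1) ^ i * ι R w :=
      ((Commute.neg_one_right _).pow_right i).eq
    rw [mul_assoc, ih, ← mul_assoc, hcomm, mul_assoc, ← mul_assoc (ι R w), hswap, pow_succ]
    simp [mul_assoc]

variable {𝒞 : Set (Finset (Fin n))}

lemma bdry_mem_osIdeal {C : Finset (Fin n)} (hC : C ∈ 𝒞) : bdry R n C ∈ osIdeal R n 𝒞 :=
  Submodule.subset_span ⟨1, 1, C, hC, by simp⟩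

lemma mul_mem_osIdeal_left (a : ExteriorAlgebra R (Fin n → R))
    {x : ExteriorAlgebra R (Fin n → R)} (hx : x ∈ osIdeal R n 𝒞) : a * x ∈ osIdeal R n 𝒞 := by
  unfold osIdeal at hx
  induction hx using Submodule.span_induction with
  | mem x hx =>
    obtain ⟨b, c, C, hC, rfl⟩ := hx
    exact Submodule.subset_span ⟨a * b, c, C, hC, by simp only [mul_assoc]⟩
  | zero => simp
  | add x y _ _ hx hy => rw [mul_add]; exact add_mem hx hy
  | smul r x _ hx => rw [mul_smul_comm]; exact Submodule.smul_mem _ r hx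

lemma decIdeal_le_osIdeal : decIdeal R n 𝒞 ≤ osIdeal R n 𝒞 :=
  Submodule.mul_le.2 fun a _ _ hx ↦ mul_mem_osIdeal_left a hx

/-- Multiplying a homogeneous element of the ideal generated by `bdry C` on the right by an element
of positive degree gives a decomposable element. -/
lemma mul_bdry_mul_mem_decIdeal {i j : ℕ} {a b : ExteriorAlgebra R (Fin n → R)}
    (ha : a ∈ lamGrade R n i) (hb : b ∈ lamGrade R n (j + 1)) {C : Finset (Fin n)} (hC : C ∈ 𝒞) :
    a * bdry R n C * b ∈ decIdeal R n 𝒞 := by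
  rw [lamGrade, pow_succ'] at hb
  induction hb using Submodule.mul_induction_on' with
  | mem_mul_mem m hm c _ =>
    obtain ⟨v, rfl⟩ := hm
    rw [← mul_assoc, mul_ι_eq_neg_one_pow_mul (mul_mem_lamGrade ha (bdry_mem_lamGrade C)) v,
      mul_assoc]
    refine neg_one_pow_mul_mem _ ?_
    rw [mul_assoc]
    refine Submodule.mul_mem_mul (mem_lamPlus one_pos ?_)
      (Submodule.subset_span ⟨a, c, C, hC, rfl⟩)
    rw [lamGrade, pow_one]
    exact LinearMap.mem_range_self _ _
  | add x _ y _ hx hy => rw [mul_add]; exact add_mem hx hy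

/-- A homogeneous multiple of `bdry C` is a scalar multiple of `bdry C` or decomposable. -/
lemma mul_bdry_mul_mem_span_or_mem_decIdeal {i j : ℕ} {a b : ExteriorAlgebra R (Fin n → R)}
    (ha : a ∈ lamGrade R n i) (hb : b ∈ lamGrade R n j) {C : Finset (Fin n)} (hC : C ∈ 𝒞) :
    (i + j = 0 ∧ a * bdry R n C * b ∈ Submodule.span R {bdry R n C}) ∨
      a * bdry R n C * b ∈ decIdeal R n 𝒞 := by
  rcases j with _ | j
  · rcases Nat.eq_zero_or_pos i with rfl | hi
    · rw [lamGrade, pow_zero, Submodule.mem_one] at ha hb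
      obtain ⟨r, rfl⟩ := ha
      obtain ⟨s, rfl⟩ := hb
      refine Or.inl ⟨rfl, Submodule.mem_span_singleton.2 ⟨s * r, ?_⟩⟩
      rw [← Algebra.commutes, ← Algebra.smul_def, ← Algebra.smul_def, smul_smul]
    · right
      rw [mul_assoc]
      exact Submodule.mul_mem_mul (mem_lamPlus hi ha)
        (Submodule.subset_span ⟨1, b, C, hC, by simp⟩)
  · exact Or.inr (mul_bdry_mul_mem_decIdeal ha hb hC)

/-- Every homogeneous component of an element of the Orlik–Solomon ideal is, modulo decomposables,
a combination of boundaries of the right degree. -/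
lemma proj_mem_of_mem_osIdeal (hne : ∀ C ∈ 𝒞, C.Nonempty) (q : ℕ)
    {x : ExteriorAlgebra R (Fin n → R)} (hx : x ∈ osIdeal R n 𝒞) :
    GradedAlgebra.proj (fun i : ℕ ↦ ⋀[R]^i (Fin n → R)) q x ∈
      Submodule.span R {x | ∃ C ∈ 𝒞, C.card = q + 1 ∧ x = bdry R n C} ⊔
        (decIdeal R n 𝒞 ⊓ lamGrade R n q) := by
  unfold osIdeal at hx
  induction hx using Submodule.span_induction with
  | zero => rw [map_zero]; exact zero_mem _
  | add x y _ _ hx hy => rw [map_add]; exact add_mem hx hy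
  | smul r x _ hx => rw [map_smul]; exact Submodule.smul_mem _ r hx
  | mem x hx =>
    obtain ⟨a, b, C, hC, rfl⟩ := hx
    induction a using DirectSum.Decomposition.inductionOn fun i : ℕ ↦ ⋀[R]^i (Fin n → R) with
    | zero => simp only [zero_mul, map_zero]; exact zero_mem _
    | add a a' h h' => simp only [add_mul, map_add]; exact add_mem h h'
    | @homogeneous i a =>
    induction b using DirectSum.Decomposition.inductionOn fun i : ℕ ↦ ⋀[R]^i (Fin n → R) with
    | zero => simp only [mul_zero, map_zero]; exact zero_mem _
    | add b b' h h' => simp only [mul_add, map_add]; exact add_mem h h'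
    | @homogeneous j b =>
    have ha : (a : ExteriorAlgebra R (Fin n → R)) ∈ lamGrade R n i := a.2
    have hb : (b : ExteriorAlgebra R (Fin n → R)) ∈ lamGrade R n j := b.2
    have hdeg := mul_mem_lamGrade (mul_mem_lamGrade ha (bdry_mem_lamGrade C)) hb
    rw [GradedAlgebra.proj_apply]
    by_cases hq : i + (C.card - 1) + j = q
    · subst hq
      rw [DirectSum.decompose_of_mem_same (fun i : ℕ ↦ ⋀[R]^i (Fin n → R)) hdeg]
      rcases mul_bdry_mul_mem_span_or_mem_decIdeal ha hb hC with ⟨hij, h⟩ | h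
      · refine Submodule.mem_sup_left (Submodule.span_mono ?_ h)
        rintro _ rfl
        have := (hne C hC).card_pos
        exact ⟨C, hC, by lia, rfl⟩
      · exact Submodule.mem_sup_right ⟨h, hdeg⟩
    · rw [DirectSum.decompose_of_mem_ne (fun i : ℕ ↦ ⋀[R]^i (Fin n → R)) hdeg hq]
      exact zero_mem _

end Grading

/-- Over any field `K`, the degree-`q` component of `I(M)/Λ⁺I(M)` is spanned
by the classes of the boundaries of `(q+1)`-circuits:
`I(M)^q_K = span_K{∂(e_C) : C ∈ C_{q+1}(M)} + (Λ⁺I(M))^q_K`. -/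
theorem stmt_3 (n : ℕ) (hn : 1 ≤ n) (K : Type*) [Field K]
    (M : Matroid (Fin n)) (hsimple : IsSimple n M) (q : ℕ) :
    osIdeal K n (circuits n M) ⊓ lamGrade K n q =
      Submodule.span K {x | ∃ C : Finset (Fin n), IsCct n M C ∧ C.card = q + 1 ∧
          x = bdry K n C} ⊔
        (decIdeal K n (circuits n M) ⊓ lamGrade K n q) := by
  have hne : ∀ C ∈ circuits n M, C.Nonempty := by
    rintro C ⟨hC, -⟩
    simpa using hC.nonempty
  refine le_antisymm ?_ (sup_le ?_ (inf_le_inf_right _ decIdeal_le_osIdeal))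
  · rintro x ⟨hx, hxq⟩
    have h := proj_mem_of_mem_osIdeal hne q hx
    rw [GradedAlgebra.proj_apply, DirectSum.decompose_of_mem_same (fun i : ℕ ↦ ⋀[K]^i (Fin n → K)) hxq] at h
    exact h
  · rw [Submodule.span_le]
    rintro _ ⟨C, hC, hcard, rfl⟩
    refine ⟨bdry_mem_osIdeal hC, ?_⟩
    have h := bdry_mem_lamGrade (R := K) C
    rwa [hcard, Nat.add_sub_cancel] at h
end

section
/- Let M be a simple matroid on [n], K a field, π a permutation of [n], and q ≥ 0. Then the family {∂(e_C) : C ∈ C^π_{q+1}(M)} is linearly independent in Λ^q_K; equivalently, the restriction of ∂ to the K-span of {e_C : C ∈ C^π_{q+1}(M)} is injective. -/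
open ExteriorAlgebra

variable (R : Type*) [CommRing R] (n : ℕ)

section OrlikSolomon

/-- The monomials `e_X` are the standard basis of the exterior algebra. -/
lemma eMon_eq_basis (X : Finset (Fin n)) :
    eMon R n X = (Pi.basisFun R (Fin n)).ExteriorAlgebra X := by
  rw [ExteriorAlgebra.basis_apply_ofCard (Pi.basisFun R (Fin n)) (rfl : X.card = X.card),
    ExteriorAlgebra.ιMulti_family, ExteriorAlgebra.ιMulti_apply, eMon,
    ← Finset.listMap_orderEmbOfFin_finRange X rfl,
    List.map_map, List.ofFn_eq_map]
  congr 1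
  refine List.map_congr_left fun i _ => ?_
  simp [gen, Set.powersetCard.ofFinEmbEquiv_symm_apply, Set.powersetCard.ofCard]

/-- The coefficient of `e_Y` in `∂(e_X)`. -/
lemma repr_bdry (X Y : Finset (Fin n)) :
    (Pi.basisFun R (Fin n)).ExteriorAlgebra.repr (bdry R n X) Y =
      ∑ i ∈ X, (-1 : R) ^ (X.filter (fun j => j < i)).card *
        if X.erase i = Y then 1 else 0 := by
  have h : ∀ i, (-1 : ExteriorAlgebra R (Fin n → R)) ^ (X.filter (fun j => j < i)).card
      * eMon R n (X.erase i) = (-1 : R) ^ (X.filter (fun j => j < i)).card •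
        (Pi.basisFun R (Fin n)).ExteriorAlgebra (X.erase i) := fun i => by
    rw [eMon_eq_basis, Algebra.smul_def]
    simp
  simp only [bdry, h, map_sum, map_smul, Module.Basis.repr_self, Finsupp.coe_finsetSum,
    Finset.sum_apply, Finsupp.smul_apply, Finsupp.single_apply, smul_eq_mul]

variable {n} in
lemma repr_bdry_erase_self {X : Finset (Fin n)} {a : Fin n} (ha : a ∈ X) :
    (Pi.basisFun R (Fin n)).ExteriorAlgebra.repr (bdry R n X) (X.erase a) =
      (-1 : R) ^ (X.filter (fun j => j < a)).card := by
  rw [repr_bdry, Finset.sum_eq_single_of_mem a ha]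
  · simp
  · intro b hb hba
    rw [if_neg fun h => hba (Finset.erase_injOn X hb ha h), mul_zero]

variable {n}

lemma IsMinP.unique {π : Equiv.Perm (Fin n)} {C : Finset (Fin n)} {a b : Fin n}
    (ha : IsMinP n π C a) (hb : IsMinP n π C b) : a = b :=
  π.injective (le_antisymm (ha.2 b hb.1) (hb.2 a ha.1))

/-- `α_π(C)` depends only on `C` with its minimum removed. -/
lemma IsAlpha.eq_of_erase_eq {M : Matroid (Fin n)} {π : Equiv.Perm (Fin n)}
    {C D : Finset (Fin n)} {a b m k : Fin n} (hC : IsMinP n π C m) (hD : IsMinP n π D k)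
    (ha : IsAlpha n M π C a) (hb : IsAlpha n M π D b) (h : D.erase k = C.erase m) : a = b := by
  obtain ⟨m', hm', ha, ha'⟩ := ha
  obtain ⟨k', hk', hb, hb'⟩ := hb
  obtain rfl := hm'.unique hC
  obtain rfl := hk'.unique hD
  rw [h] at hb hb'
  exact π.injective (le_antisymm (ha' b hb) (hb' a ha))

/-- If `C` without its minimum is a facet of `D`, then `D = C` or `D` has a larger minimum. -/
lemma eq_or_lt_of_erase_eq {M : Matroid (Fin n)} {π : Equiv.Perm (Fin n)}
    {C D : Finset (Fin n)} {a b x : Fin n} (hC : IsMinP n π C a) (hCα : IsAlpha n M π C a)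
    (hD : IsMinP n π D b) (hDα : IsAlpha n M π D b) (h : D.erase x = C.erase a) :
    D = C ∨ π a < π b := by
  by_cases hxb : x = b
  · subst hxb
    obtain rfl := hCα.eq_of_erase_eq hC hD hDα h
    left
    rw [← Finset.insert_erase hC.1, ← h, Finset.insert_erase hD.1]
  · right
    have hb : b ∈ C.erase a := h ▸ Finset.mem_erase.2 ⟨Ne.symm hxb, hD.1⟩
    rw [Finset.mem_erase] at hb
    exact lt_of_le_of_ne (hC.2 b hb.2) (π.injective.ne (Ne.symm hb.1))

end OrlikSolomon

/-- For any permutation `π` of `[n]` and any `q`, the family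
`{∂(e_C) : C ∈ C^π_{q+1}(M)}` is linearly independent in `Λ^q_K` (equivalently,
the restriction of `∂` to the `K`-span of `{e_C : C ∈ C^π_{q+1}(M)}` is injective). -/
theorem stmt_4 (n : ℕ) (hn : 1 ≤ n) (K : Type*) [Field K]
    (M : Matroid (Fin n)) (hsimple : IsSimple n M) (π : Equiv.Perm (Fin n)) (q : ℕ) :
    LinearIndependent K
      (fun C : {C : Finset (Fin n) // InCpi n M π C ∧ C.card = q + 1} =>
        bdry K n C.1) := by
  classical
  choose a ha hα using fun C : {C : Finset (Fin n) // InCpi n M π C ∧ C.card = q + 1} =>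
    C.2.1.1.2
  rw [linearIndependent_iff']
  intro s g hg
  by_contra! hne
  obtain ⟨C₀, hC₀, hgC₀⟩ := hne
  obtain ⟨C, hC, hmax⟩ := (s.filter fun C => g C ≠ 0).exists_max_image (fun C => π (a C))
    ⟨C₀, Finset.mem_filter.2 ⟨hC₀, hgC₀⟩⟩
  rw [Finset.mem_filter] at hC
  have hcoeff := congrArg
    (fun v => (Pi.basisFun K (Fin n)).ExteriorAlgebra.repr v (C.1.erase (a C))) hg
  simp only [map_sum, map_smul, Finsupp.coe_finsetSum, Finset.sum_apply, Finsupp.smul_apply,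
    smul_eq_mul, map_zero, Finsupp.coe_zero, Pi.zero_apply] at hcoeff
  rw [Finset.sum_eq_single_of_mem C hC.1, repr_bdry_erase_self K (ha C).1] at hcoeff
  · exact mul_ne_zero hC.2 (pow_ne_zero _ (neg_ne_zero.2 one_ne_zero)) hcoeff
  · intro D hD hDC
    by_cases hgD : g D = 0
    · rw [hgD, zero_mul]
    · rw [repr_bdry, Finset.sum_eq_zero, mul_zero]
      intro x _
      rw [if_neg, mul_zero]
      intro h
      rcases eq_or_lt_of_erase_eq (ha C) (hα C) (ha D) (hα D) h with h | h
      · exact hDC (Subtype.ext h)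
      · exact (hmax D (Finset.mem_filter.2 ⟨hD, hgD⟩)).not_gt h
end

section
/- Let M be a simple matroid on [n], π a permutation of [n], and C̄ = {i_1, …, i_p} a circuit of M with i_1 <_π i_2 <_π ⋯ <_π i_p and i_1 = α_π(C̄). Fix j with 1 < j ≤ p, and let π' be the permutation of [n] obtained from π by moving i_j immediately before i_1, i.e., π'⁻¹(k) = π⁻¹(k) for k < π(i_1) or k > π(i_j), π'⁻¹(π(i_1)) = i_j, and π'⁻¹(k) = π⁻¹(k−1) for π(i_1) < k ≤ π(i_j). Then every element m ∈ [n] that is active with respect to the independent set C̄ \ {i_j} relative to <_{π'} satisfies i_j ≤_{π'} m; consequently α_{π'}(C̄) = i_j. -/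
open ExteriorAlgebra

variable (R : Type*) [CommRing R] (n : ℕ)

/-- The circuits of `IsCct` are the circuits of Mathlib. -/
theorem IsCct.isCircuit {n : ℕ} {M : Matroid (Fin n)} {C : Finset (Fin n)}
    (h : IsCct n M C) : M.IsCircuit (C : Set (Fin n)) := by
  refine ⟨h.1, fun D hD hDC => ?_⟩
  by_contra hCD
  lift D to Finset (Fin n) using D.toFinite
  exact h.2 D ⟨Finset.coe_subset.1 hDC, fun h' => hCD (Finset.coe_subset.2 h')⟩ hD

theorem isCct_of_isCircuit {n : ℕ} {M : Matroid (Fin n)} {C : Finset (Fin n)}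
    (h : M.IsCircuit (C : Set (Fin n))) : IsCct n M C :=
  ⟨h.dep, fun _ hD hdep => hD.2 (Finset.coe_subset.1 (h.2 hdep (Finset.coe_subset.2 hD.1)))⟩

/-- If `m ∉ C` lies on a circuit inside `(C \ {a}) ∪ {m}`, where `C` is a circuit, then for every
`b` it lies on a circuit inside `(C \ {b}) ∪ {m}`. -/
theorem IsCct.exchange {n : ℕ} {M : Matroid (Fin n)} {C D : Finset (Fin n)} {a m : Fin n}
    (hC : IsCct n M C) (hD : IsCct n M D) (hmC : m ∉ C) (hmD : m ∈ D)
    (hDC : D ⊆ insert m (C.erase a)) (b : Fin n) :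
    ∃ D', IsCct n M D' ∧ m ∈ D' ∧ D' ⊆ insert m (C.erase b) := by
  have hm : m ∈ M.closure ((C : Set (Fin n)) \ {b}) := by
    rw [hC.isCircuit.closure_sdiff_singleton_eq b]
    refine M.closure_subset_closure ?_ (hD.isCircuit.mem_closure_sdiff_singleton_of_mem hmD)
    rintro x ⟨hxD, hxm⟩
    rcases Finset.mem_insert.1 (hDC hxD) with h | h
    · exact absurd h hxm
    · exact Finset.mem_of_mem_erase h
  obtain ⟨D', hsub, hcirc, hmD'⟩ :=
    (Matroid.mem_closure_iff_exists_isCircuit (fun h => hmC h.1)).1 hm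
  lift D' to Finset (Fin n) using D'.toFinite
  refine ⟨D', isCct_of_isCircuit hcirc, hmD', fun x hx => ?_⟩
  rw [Finset.mem_insert, Finset.mem_erase]
  rcases hsub hx with h | h
  · exact Or.inl h
  · exact Or.inr ⟨h.2, h.1⟩

/-- Let `C̄` be a circuit with `<_π`-minimal element `i1 = α_π(C̄)`, let
`ij ∈ C̄`, `ij ≠ i1`, and let `π'` be obtained from `π` by moving `ij` immediately before
`i1`.  Then every `m` active w.r.t. `C̄ \ {ij}` relative to `<_{π'}` satisfies
`ij ≤_{π'} m`; consequently `α_{π'}(C̄) = ij`. -/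
theorem stmt_7 (n : ℕ) (hn : 1 ≤ n) (M : Matroid (Fin n)) (hsimple : IsSimple n M)
    (π π' : Equiv.Perm (Fin n)) (Cbar : Finset (Fin n)) (i1 ij : Fin n)
    (hCbar : IsCct n M Cbar)
    (hmin : IsMinP n π Cbar i1) (halpha : IsAlpha n M π Cbar i1)
    (hij : ij ∈ Cbar) (hne : ij ≠ i1)
    -- π' is obtained from π by moving ij immediately before i1 :
    (h1 : ∀ k : Fin n, (k < π i1 ∨ π ij < k) → π'.symm k = π.symm k)
    (h2 : π'.symm (π i1) = ij)
    (h3 : ∀ k : Fin n, π i1 < k → k ≤ π ij → π'.symm k = π.symm ⟨k.val - 1, lt_of_le_of_lt (Nat.sub_le _ _) k.isLt⟩) :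
    (∀ m : Fin n, IsActive n M π' (Cbar.erase ij) m → π' ij ≤ π' m) ∧
      IsAlpha n M π' Cbar ij := by
  have himg : π' ij = π i1 := by rw [← h2, Equiv.apply_symm_apply]
  have hlow : ∀ x, π' x < π i1 → π x = π' x := fun x hx => by
    rw [← Equiv.eq_symm_apply, ← h1 _ (Or.inl hx), Equiv.symm_apply_apply]
  have hmin' : IsMinP n π' Cbar ij := by
    refine ⟨hij, fun b hb => ?_⟩
    by_contra! hlt
    rw [himg] at hlt
    exact absurd (hmin.2 b hb) (by rw [hlow b hlt]; exact hlt.not_ge)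
  have hact : ∀ m, IsActive n M π' (Cbar.erase ij) m → π' ij ≤ π' m := by
    rintro m ⟨C, hC, hCsub, hmC, -⟩
    by_contra! hlt
    have hm : π m < π i1 := by
      rw [himg] at hlt
      rwa [hlow m hlt]
    have hmCbar : m ∉ Cbar := fun h => (hmin.2 m h).not_gt hm
    obtain ⟨D, hD, hmD, hDsub⟩ := hCbar.exchange hC hmCbar hmC hCsub i1
    obtain ⟨a, ha, -, hle⟩ := halpha
    obtain rfl : a = i1 := π.injective ((ha.2 i1 hmin.1).antisymm (hmin.2 a ha.1))
    refine (hle m ⟨D, hD, hDsub, hmD, fun b hb => ?_⟩).not_gt hm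
    rcases Finset.mem_insert.1 (hDsub hb) with rfl | h
    · exact le_rfl
    · exact hm.le.trans (hmin.2 b (Finset.mem_of_mem_erase h))
  exact ⟨hact, ij, hmin', ⟨Cbar, hCbar, (Finset.insert_erase hij).ge, hmin'⟩, hact⟩
end

section
/- Let M be the matroid on the six-element ground set {x, y, z, t, H, P} whose circuits are exactly {H,P,y,z}, {H,P,x,t}, {H,x,y,z,t}, {P,x,y,z,t} (the matroid of the arrangement xyzt(x+y+z+t)(x−y−z+t) = 0 in ℂ^4). Then for any field K: dim_K (I(M)/Λ⁺I(M))^4_K = 1; (Λ⁺I(M))^q_K = 0 for q ≤ 3, so (I(M)/Λ⁺I(M))^q_K = I(M)^q_K for q < 4; and I(M)^q_K = (Λ⁺I(M))^q_K, i.e., (I(M)/Λ⁺I(M))^q_K = 0, for q > 4. -/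
/-- A monomial order on the exterior algebra `Λ_K` on `n` generators, realized as a strict
total order on the monomials `e_X` (identified with their index sets `X ⊆ [n]`), such that
`1 = e_∅` is smallest and the order is compatible with multiplication: note that
`e_X ∧ e_Z ≠ 0` iff `X` and `Z` are disjoint, in which case the underlying monomial of
`e_X ∧ e_Z` is `e_{X ∪ Z}`. -/
structure MonOrder (n : ℕ) where
  lt : Finset (Fin n) → Finset (Fin n) → Prop
  irrefl : ∀ X, ¬ lt X X
  trans : ∀ X Y Z, lt X Y → lt Y Z → lt X Z
  total : ∀ X Y, X ≠ Y → lt X Y ∨ lt Y X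
  one_lt : ∀ X, X ≠ ∅ → lt ∅ X
  mul_compat : ∀ X Y Z, lt X Y → Disjoint X Z → Disjoint Y Z → lt (X ∪ Z) (Y ∪ Z)

variable (K : Type*) [Field K] (n : ℕ)

/-- The exterior algebra `Λ_K` on `n` generators as a `K`-vector space: an element is the
finitely supported family of its coordinates in the monomial basis `{e_X : X ⊆ [n]}`. -/
abbrev ExtF (K : Type*) [Field K] (n : ℕ) := Finset (Fin n) →₀ K

/-- `∂(e_X) = Σ_k (−1)^{k−1} e_{X \ {i_k}}`, in monomial coordinates. -/
noncomputable def bdryF (X : Finset (Fin n)) : ExtF K n :=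
  ∑ i ∈ X, ((-1 : K) ^ (X.filter (fun j => j < i)).card) •
    Finsupp.single (X.erase i) (1 : K)

/-- `X` is the initial monomial `in_≺(f)`: the `≺`-largest monomial in the support of `f`. -/
def IsInitial (ord : MonOrder n) (f : ExtF K n) (X : Finset (Fin n)) : Prop :=
  X ∈ f.support ∧ ∀ Y ∈ f.support, Y ≠ X → ord.lt Y X

/-- The Koszul-type sign `ε(S, Y)` with `e_S ∧ e_Y = ε(S, Y) e_{S ∪ Y}` for disjoint `S, Y`. -/
def sgn (S Y : Finset (Fin n)) : K :=
  (-1 : K) ^ ((S ×ˢ Y).filter (fun p => p.2 < p.1)).card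

/-- Left multiplication by the monomial `e_S`. -/
noncomputable def mulMon (S : Finset (Fin n)) (f : ExtF K n) : ExtF K n :=
  f.sum fun Y c =>
    if Disjoint S Y then (sgn K n S Y * c) • Finsupp.single (S ∪ Y) (1 : K) else 0

/-- The Orlik–Solomon ideal `I(M)_K`: the (two-sided) ideal generated by the boundaries
`∂(e_C)` of circuits; since each `∂(e_C)` is homogeneous, it is the span of the monomial
multiples `e_S ∂(e_C)`. -/
noncomputable def idealF (cs : Set (Finset (Fin n))) : Submodule K (ExtF K n) :=
  Submodule.span K {f | ∃ S : Finset (Fin n), ∃ C ∈ cs, f = mulMon K n S (bdryF K n C)}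

/-- The decomposable Orlik–Solomon ideal `Λ⁺I(M)_K`: the span of the monomial multiples
`e_S ∂(e_C)` with `e_S` of strictly positive degree. -/
noncomputable def decIdealF (cs : Set (Finset (Fin n))) : Submodule K (ExtF K n) :=
  Submodule.span K
    {f | ∃ S : Finset (Fin n), S ≠ ∅ ∧ ∃ C ∈ cs, f = mulMon K n S (bdryF K n C)}

/-- The degree-`q` graded component `Λ^q_K`: the span of the monomials `e_X` with `|X| = q`. -/
def gradeF (q : ℕ) : Submodule K (ExtF K n) where
  carrier := {f | ∀ X ∈ f.support, X.card = q}
  add_mem' := by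
    intro f g hf hg X hX
    rcases Finset.mem_union.mp (Finsupp.support_add hX) with h | h
    · exact hf X h
    · exact hg X h
  zero_mem' := by intro X hX; simp at hX
  smul_mem' := by
    intro c f hf X hX
    exact hf X (Finsupp.support_smul hX)

/-- `G` is a reduced Gröbner basis of the ideal `I` with respect to the monomial order
`ord`: `G` is a finite subset of `I` such that the initial monomial of every nonzero `f ∈ I`
is divisible by the initial monomial of some `g ∈ G` (`e_X` divides `e_Y` iff `X ⊆ Y`);
every `g ∈ G` has leading coefficient `1`; and for `g ≠ g'` in `G`, no monomial in the
support of `g'` is divisible by the initial monomial of `g`. -/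
def IsRedGB (ord : MonOrder n) (G : Set (ExtF K n)) (I : Submodule K (ExtF K n)) : Prop :=
  G.Finite ∧ G ⊆ (I : Set (ExtF K n)) ∧
  (∀ f ∈ I, f ≠ 0 → ∃ g ∈ G, ∀ X Y,
    IsInitial K n ord f X → IsInitial K n ord g Y → Y ⊆ X) ∧
  (∀ g ∈ G, ∀ Y, IsInitial K n ord g Y → g Y = 1) ∧
  (∀ g ∈ G, ∀ g' ∈ G, g ≠ g' → ∀ Y, IsInitial K n ord g Y → ∀ X ∈ g'.support, ¬ Y ⊆ X)

/-- The circuits of the matroid of the arrangement `xyzt(x+y+z+t)(x−y−z+t) = 0` in `ℂ⁴`,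
on the six-element ground set `{x, y, z, t, H, P}` identified with `Fin 6` via
`x = 0, y = 1, z = 2, t = 3, H = 4, P = 5`: the circuits are
`{H,P,y,z}, {H,P,x,t}, {H,x,y,z,t}, {P,x,y,z,t}`. -/
def exCircuits : Set (Finset (Fin 6)) :=
  {({4, 5, 1, 2} : Finset (Fin 6)), ({4, 5, 0, 3} : Finset (Fin 6)),
   ({4, 0, 1, 2, 3} : Finset (Fin 6)), ({5, 0, 1, 2, 3} : Finset (Fin 6))}

/-- The integer coefficient of `e_X` in `e_S ∂(e_C)`. -/
def mulBdryCoeff {n : ℕ} (S C X : Finset (Fin n)) : ℤ :=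
  ∑ i ∈ C, if Disjoint S (C.erase i) ∧ S ∪ C.erase i = X then
    (-1) ^ ((S ×ˢ C.erase i).filter (fun p => p.2 < p.1)).card *
      (-1) ^ (C.filter (fun j => j < i)).card else 0

theorem mulMon_bdryF_apply (S C X : Finset (Fin n)) :
    mulMon K n S (bdryF K n C) X = (mulBdryCoeff S C X : K) := by
  unfold mulMon bdryF
  rw [← Finsupp.sum_finsetSum_index (by simp) (by
    intro Y a b; split_ifs <;> simp [mul_add, add_smul])]
  rw [Finsupp.finsetSum_apply, mulBdryCoeff, Int.cast_sum]
  refine Finset.sum_congr rfl fun i _ => ?_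
  rw [Finsupp.smul_single_one, Finsupp.sum_single_index (by simp)]
  by_cases h : Disjoint S (C.erase i)
  · by_cases h' : S ∪ C.erase i = X <;> simp [h, h', sgn]
  · simp [h]

theorem card_of_mulBdryCoeff_ne_zero {S C X : Finset (Fin n)} (h : mulBdryCoeff S C X ≠ 0) :
    X.card + 1 = S.card + C.card := by
  obtain ⟨i, hi, h⟩ := Finset.exists_ne_zero_of_sum_ne_zero h
  rw [ne_eq, ite_eq_right_iff, Classical.not_imp] at h
  obtain ⟨⟨hd, rfl⟩, -⟩ := h
  rw [Finset.card_union_of_disjoint hd, add_assoc, Finset.card_erase_add_one hi]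

theorem mem_gradeF_iff {q : ℕ} {f : ExtF K n} :
    f ∈ gradeF K n q ↔ ∀ X, f X ≠ 0 → X.card = q := by
  change (∀ X ∈ f.support, X.card = q) ↔ _
  simp

theorem mulMon_bdryF_mem_gradeF {q : ℕ} {S C : Finset (Fin n)} (h : q + 1 = S.card + C.card) :
    mulMon K n S (bdryF K n C) ∈ gradeF K n q := by
  rw [mem_gradeF_iff]
  intro X hX
  rw [mulMon_bdryF_apply] at hX
  have := card_of_mulBdryCoeff_ne_zero n (X := X) (S := S) (C := C) fun h0 => hX (by simp [h0])
  omega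

/-- The projection onto the degree-`q` component. -/
noncomputable def gradeProj (q : ℕ) : ExtF K n →ₗ[K] ExtF K n where
  toFun f := f.filter fun X => X.card = q
  map_add' _ _ := Finsupp.filter_add
  map_smul' _ _ := Finsupp.filter_smul

theorem gradeProj_of_mem {q : ℕ} {f : ExtF K n} (hf : f ∈ gradeF K n q) :
    gradeProj K n q f = f :=
  (Finsupp.filter_eq_self_iff _ _).2 ((mem_gradeF_iff K n).1 hf)

theorem gradeProj_mulMon_bdryF (q : ℕ) (S C : Finset (Fin n)) :
    gradeProj K n q (mulMon K n S (bdryF K n C)) =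
      if q + 1 = S.card + C.card then mulMon K n S (bdryF K n C) else 0 := by
  split_ifs with h
  · exact gradeProj_of_mem K n (mulMon_bdryF_mem_gradeF K n h)
  · refine (Finsupp.filter_eq_zero_iff _ _).2 fun X hX => ?_
    rw [mulMon_bdryF_apply]
    by_contra h0
    have := card_of_mulBdryCoeff_ne_zero n (X := X) (S := S) (C := C) fun h1 => h0 (by simp [h1])
    omega

/-- To place the homogeneous elements of `I` of degree `q` in a subspace, it is enough to place
there the generators of degree `q`. -/
theorem mem_of_mem_span_of_mem_gradeF {q : ℕ} {s : Set (ExtF K n)} {V : Submodule K (ExtF K n)}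
    (hs : ∀ g ∈ s, gradeProj K n q g ∈ V) {f : ExtF K n} (hf : f ∈ Submodule.span K s)
    (hq : f ∈ gradeF K n q) : f ∈ V := by
  rw [← gradeProj_of_mem K n hq]
  exact (Submodule.span_le (p := V.comap (gradeProj K n q))).2 hs hf

theorem card_mem_Icc_of_mem_exCircuits {C : Finset (Fin 6)} (hC : C ∈ exCircuits) :
    4 ≤ C.card ∧ C.card ≤ 5 := by
  rcases hC with rfl | rfl | rfl | rfl <;> decide

theorem mulBdryCoeff_xyzt {S C : Finset (Fin 6)} (hS : S ≠ ∅) (hC : C ∈ exCircuits) :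
    mulBdryCoeff S C {0, 1, 2, 3} = 0 := by
  refine Finset.sum_eq_zero fun i hi => if_neg ?_
  revert S i
  rcases hC with rfl | rfl | rfl | rfl <;> decide +kernel

theorem bdry_relation :
    mulMon K 6 ∅ (bdryF K 6 {5, 0, 1, 2, 3}) =
      mulMon K 6 ∅ (bdryF K 6 {4, 0, 1, 2, 3}) +
      ((mulMon K 6 {2} (bdryF K 6 {4, 5, 0, 3}) - mulMon K 6 {1} (bdryF K 6 {4, 5, 0, 3})) +
      (mulMon K 6 {3} (bdryF K 6 {4, 5, 1, 2}) - mulMon K 6 {0} (bdryF K 6 {4, 5, 1, 2}))) := by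
  have key : ∀ X : Finset (Fin 6), mulBdryCoeff ∅ {5, 0, 1, 2, 3} X =
      mulBdryCoeff ∅ {4, 0, 1, 2, 3} X +
      ((mulBdryCoeff {2} {4, 5, 0, 3} X - mulBdryCoeff {1} {4, 5, 0, 3} X) +
      (mulBdryCoeff {3} {4, 5, 1, 2} X - mulBdryCoeff {0} {4, 5, 1, 2} X)) := by
    decide +kernel
  ext X
  simp only [Finsupp.add_apply, Finsupp.sub_apply, mulMon_bdryF_apply, key X]
  push_cast
  rfl

theorem mulMon_bdryF_mem_decIdealF {cs : Set (Finset (Fin n))} {S C : Finset (Fin n)}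
    (hS : S ≠ ∅) (hC : C ∈ cs) : mulMon K n S (bdryF K n C) ∈ decIdealF K n cs :=
  Submodule.subset_span ⟨S, hS, C, hC, rfl⟩

theorem gradeProj_mulMon_bdryF_mem_decIdealF (q : ℕ) {cs : Set (Finset (Fin n))}
    {S C : Finset (Fin n)} (hS : S ≠ ∅) (hC : C ∈ cs) :
    gradeProj K n q (mulMon K n S (bdryF K n C)) ∈ decIdealF K n cs := by
  rw [gradeProj_mulMon_bdryF]
  split_ifs
  · exact mulMon_bdryF_mem_decIdealF K n hS hC
  · exact zero_mem _

theorem decIdealF_le_idealF (cs : Set (Finset (Fin n))) :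
    decIdealF K n cs ≤ idealF K n cs :=
  Submodule.span_mono fun _ ⟨S, _, C, hC, hf⟩ => ⟨S, C, hC, hf⟩

theorem apply_xyzt_of_mem_decIdealF {f : ExtF K 6} (hf : f ∈ decIdealF K 6 exCircuits) :
    f {0, 1, 2, 3} = 0 := by
  refine (Submodule.span_le (p := LinearMap.ker (Finsupp.lapply {0, 1, 2, 3}))).2 ?_ hf
  rintro _ ⟨S, hS, C, hC, rfl⟩
  simp [mulMon_bdryF_apply, mulBdryCoeff_xyzt hS hC]

theorem bdry_Hxyzt_notMem_decIdealF :
    mulMon K 6 ∅ (bdryF K 6 {4, 0, 1, 2, 3}) ∉ decIdealF K 6 exCircuits := by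
  intro h
  have h1 : mulBdryCoeff (∅ : Finset (Fin 6)) {4, 0, 1, 2, 3} {0, 1, 2, 3} = 1 := by
    decide +kernel
  simpa [mulMon_bdryF_apply, h1] using apply_xyzt_of_mem_decIdealF K h

theorem idealF_inf_gradeF_four_le :
    idealF K 6 exCircuits ⊓ gradeF K 6 4 ≤ decIdealF K 6 exCircuits ⊔
      Submodule.span K {mulMon K 6 ∅ (bdryF K 6 {4, 0, 1, 2, 3})} := by
  rintro f ⟨hf, hf4⟩
  refine mem_of_mem_span_of_mem_gradeF K 6 ?_ hf hf4
  rintro _ ⟨S, C, hC, rfl⟩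
  by_cases hS : S = ∅
  · subst hS
    have hg := Submodule.mem_sup_right (S := decIdealF K 6 exCircuits)
      (Submodule.mem_span_singleton_self (R := K) (mulMon K 6 ∅ (bdryF K 6 {4, 0, 1, 2, 3})))
    rw [gradeProj_mulMon_bdryF]
    rcases hC with rfl | rfl | rfl | rfl
    · rw [if_neg (by decide)]; exact zero_mem _
    · rw [if_neg (by decide)]; exact zero_mem _
    · rwa [if_pos (by decide)]
    · rw [if_pos (by decide), bdry_relation]
      refine add_mem hg (Submodule.mem_sup_left (add_mem (sub_mem ?_ ?_) (sub_mem ?_ ?_))) <;>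
        exact mulMon_bdryF_mem_decIdealF K 6 (by decide) (by simp [exCircuits])
  · exact Submodule.mem_sup_left (gradeProj_mulMon_bdryF_mem_decIdealF K 6 4 hS hC)

theorem map_mkQ_eq_span_singleton :
    Submodule.map (decIdealF K 6 exCircuits).mkQ (idealF K 6 exCircuits ⊓ gradeF K 6 4) =
      Submodule.span K
        {(decIdealF K 6 exCircuits).mkQ (mulMon K 6 ∅ (bdryF K 6 {4, 0, 1, 2, 3}))} := by
  refine le_antisymm ?_ ?_
  · refine (Submodule.map_mono (idealF_inf_gradeF_four_le K)).trans ?_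
    rw [Submodule.map_sup, Submodule.mkQ_map_self, bot_sup_eq, Submodule.map_span,
      Set.image_singleton]
  · rw [Submodule.span_singleton_le_iff_mem]
    exact Submodule.mem_map_of_mem ⟨Submodule.subset_span ⟨∅, _, by simp [exCircuits], rfl⟩,
      mulMon_bdryF_mem_gradeF K 6 (by decide)⟩

/-- For the matroid `M` with circuits
`{H,P,y,z}, {H,P,x,t}, {H,x,y,z,t}, {P,x,y,z,t}` and any field `K`:
`dim_K (I(M)/Λ⁺I(M))^4_K = 1` (the degree-4 component being realized as the image of
`I(M)^4_K` in `Λ_K/Λ⁺I(M)_K`); `(Λ⁺I(M))^q_K = 0` for `q ≤ 3`, so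
`(I(M)/Λ⁺I(M))^q_K = I(M)^q_K` for `q < 4`; and `I(M)^q_K = (Λ⁺I(M))^q_K`, i.e.
`(I(M)/Λ⁺I(M))^q_K = 0`, for `q > 4`. -/
theorem stmt_14 (K : Type*) [Field K] :
    Module.finrank K
        ↥(Submodule.map (decIdealF K 6 exCircuits).mkQ
          (idealF K 6 exCircuits ⊓ gradeF K 6 4)) = 1 ∧
    (∀ q : ℕ, q ≤ 3 → decIdealF K 6 exCircuits ⊓ gradeF K 6 q = ⊥) ∧
    (∀ q : ℕ, 4 < q →
      idealF K 6 exCircuits ⊓ gradeF K 6 q = decIdealF K 6 exCircuits ⊓ gradeF K 6 q) := by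
  refine ⟨?_, fun q hq => ?_, fun q hq => ?_⟩
  · rw [map_mkQ_eq_span_singleton]
    refine finrank_span_singleton ?_
    rw [Submodule.mkQ_apply, ne_eq, Submodule.Quotient.mk_eq_zero]
    exact bdry_Hxyzt_notMem_decIdealF K
  · rw [eq_bot_iff]
    rintro f ⟨hf, hfq⟩
    refine mem_of_mem_span_of_mem_gradeF K 6 ?_ hf hfq
    rintro _ ⟨S, hS, C, hC, rfl⟩
    have := card_mem_Icc_of_mem_exCircuits hC
    have := Finset.card_pos.2 (Finset.nonempty_iff_ne_empty.2 hS)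
    rw [gradeProj_mulMon_bdryF, if_neg (by omega)]
    exact zero_mem _
  · refine le_antisymm ?_ (inf_le_inf_right _ (decIdealF_le_idealF K 6 exCircuits))
    rintro f ⟨hf, hfq⟩
    refine ⟨mem_of_mem_span_of_mem_gradeF K 6 ?_ hf hfq, hfq⟩
    rintro _ ⟨S, C, hC, rfl⟩
    by_cases hS : S = ∅
    · have := card_mem_Icc_of_mem_exCircuits hC
      rw [gradeProj_mulMon_bdryF, if_neg (by rw [hS, Finset.card_empty]; omega)]
      exact zero_mem _
    · exact gradeProj_mulMon_bdryF_mem_decIdealF K 6 q hS hC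
end
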